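/- For a probability-like matrix domain, define S_FD(X) = Tr[X log X] + Tr[(I−X) log(I−X)] on 𝒳_τ := {X symmetric : 0 ⪯ X ⪯ I, Tr X ≤ τ} for τ ≥ 1. Then S_FD is (1/τ)-strongly convex on 𝒳_τ with respect to the nuclear norm: for all X in the (relative interior of the) domain and all symmetric directions Z, ⟨Z, ∇²S_FD(X)[Z]⟩ ≥ (1/τ)‖Z‖_*², where ‖·‖_* is the nuclear (trace) norm. -/

import Mathlib

open Matrix

/-- The Fermi-Dirac entropy `Tr[X log X] + Tr[(I-X) log(I-X)]`, computed spectrally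
(junk value `0` on non-Hermitian matrices). -/
noncomputable def fermiDiracEntropy {n : ℕ} (X : Matrix (Fin n) (Fin n) ℝ) : ℝ :=
  if h : X.IsHermitian then
    ∑ i, (h.eigenvalues i * Real.log (h.eigenvalues i)
      + (1 - h.eigenvalues i) * Real.log (1 - h.eigenvalues i))
  else 0

section Helpers

open scoped Matrix.Norms.L2Operator
open Unitary Filter Topology

variable {m : Type*} [Fintype m] [DecidableEq m]

lemma trace_conjStarAlgAut (U : unitaryGroup m ℝ) (A : Matrix m m ℝ) :
    (conjStarAlgAut ℝ (Matrix m m ℝ) U A).trace = A.trace := by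
  rw [conjStarAlgAut_apply, trace_mul_cycle]
  simp

lemma norm_conjStarAlgAut (U : unitaryGroup m ℝ) (A : Matrix m m ℝ) :
    ‖conjStarAlgAut ℝ (Matrix m m ℝ) U A‖ = ‖A‖ := by
  rw [conjStarAlgAut_apply, ← Unitary.coe_star, CStarRing.norm_mul_coe_unitary,
    CStarRing.norm_coe_unitary_mul]

lemma exists_conjStarAlgAut_diagonal {A : Matrix m m ℝ} (hA : A.IsHermitian) :
    ∃ U : unitaryGroup m ℝ, A = conjStarAlgAut ℝ _ U (diagonal hA.eigenvalues) :=
  ⟨hA.eigenvectorUnitary, hA.spectral_theorem⟩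

lemma one_sub_conjStarAlgAut_diagonal (U : unitaryGroup m ℝ) (d : m → ℝ) :
    1 - conjStarAlgAut ℝ (Matrix m m ℝ) U (diagonal d) =
      conjStarAlgAut ℝ _ U (diagonal (1 - d)) := by
  have h : (diagonal (1 - d) : Matrix m m ℝ) = 1 - diagonal d := by
    rw [← diagonal_one, diagonal_sub]; rfl
  rw [h, map_sub, map_one]

lemma trace_conjStarAlgAut_diagonal_pow (U : unitaryGroup m ℝ) (d : m → ℝ) (k : ℕ) :
    (conjStarAlgAut ℝ (Matrix m m ℝ) U (diagonal d) ^ k).trace = ∑ i, d i ^ k := by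
  rw [← map_pow, trace_conjStarAlgAut, diagonal_pow, trace_diagonal]
  rfl

lemma abs_le_norm_conjStarAlgAut_diagonal (U : unitaryGroup m ℝ) (d : m → ℝ) (i : m) :
    |d i| ≤ ‖conjStarAlgAut ℝ (Matrix m m ℝ) U (diagonal d)‖ := by
  rw [norm_conjStarAlgAut, l2_opNorm_diagonal]
  exact norm_le_pi_norm d i

lemma norm_lt_one_of_posDef {A : Matrix m m ℝ} (hA : A.PosDef) (hA' : (1 - A).PosDef) :
    ‖A‖ < 1 := by
  obtain ⟨U, hU⟩ := exists_conjStarAlgAut_diagonal hA.1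
  have hpos := hA.eigenvalues_pos
  set d := hA.1.eigenvalues
  rw [hU, norm_conjStarAlgAut, l2_opNorm_diagonal, pi_norm_lt_iff one_pos]
  intro i
  have h1 : (diagonal (1 - d) : Matrix m m ℝ).PosDef := by
    rw [hU, one_sub_conjStarAlgAut_diagonal, conjStarAlgAut_apply] at hA'
    exact (IsUnit.posDef_star_right_conjugate_iff (Unitary.isUnit_coe (U := U))).1 hA'
  have h2 := posDef_diagonal_iff.1 h1 i
  have h3 := hpos i
  simp only [Pi.sub_apply, Pi.one_apply, sub_pos] at h2
  rw [Real.norm_eq_abs, abs_lt]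
  constructor <;> linarith

/-- The trace of the nonlinear part `∑ Aᵏ / (k (k - 1))` of the power series of
`(1 - A) log (1 - A)`. -/
noncomputable def entropySeries (A : Matrix m m ℝ) : ℝ :=
  ∑' k : ℕ, (A ^ (k + 2)).trace / ((k + 1) * (k + 2))

lemma hasSum_one_sub_mul_log_one_sub {x : ℝ} (hx : |x| < 1) :
    HasSum (fun k : ℕ => x ^ (k + 2) / ((k + 1) * (k + 2))) ((1 - x) * Real.log (1 - x) + x) := by
  have h := Real.hasSum_pow_div_log_of_abs_lt_one hx
  have h1 := (hasSum_nat_add_iff' 1).2 h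
  have h2 := (h.mul_left x).sub h1
  convert! h2 using 1
  · ext k
    push_cast
    field_simp
    ring
  · simp; ring

lemma fermiDiracEntropy_eq {n : ℕ} {A : Matrix (Fin n) (Fin n) ℝ} (hA : A.IsHermitian)
    (h : ‖A‖ < 1) (h' : ‖1 - A‖ < 1) :
    fermiDiracEntropy A = -n + (entropySeries A + entropySeries (1 - A)) := by
  obtain ⟨U, hU⟩ := exists_conjStarAlgAut_diagonal hA
  rw [fermiDiracEntropy, dif_pos hA]
  set d := hA.eigenvalues
  have hd (i) : |d i| < 1 :=
    ((abs_le_norm_conjStarAlgAut_diagonal U d i).trans_eq (by rw [← hU])).trans_lt h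
  have hd' (i) : |(1 - d) i| < 1 :=
    ((abs_le_norm_conjStarAlgAut_diagonal U (1 - d) i).trans_eq
      (by rw [← one_sub_conjStarAlgAut_diagonal, ← hU])).trans_lt h'
  have key (e : Fin n → ℝ) (he : ∀ i, |e i| < 1) :
      entropySeries (conjStarAlgAut ℝ _ U (diagonal e)) =
        ∑ i, ((1 - e i) * Real.log (1 - e i) + e i) := by
    rw [entropySeries, ← (hasSum_sum fun i _ => hasSum_one_sub_mul_log_one_sub (he i)).tsum_eq]
    simp_rw [trace_conjStarAlgAut_diagonal_pow, Finset.sum_div]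
  rw [hU, one_sub_conjStarAlgAut_diagonal, key _ hd, key _ hd', ← Finset.sum_add_distrib]
  have : (-n : ℝ) = ∑ i : Fin n, (-1 : ℝ) := by simp
  rw [this, ← Finset.sum_add_distrib]
  refine Finset.sum_congr rfl fun i _ => ?_
  simp only [Pi.sub_apply, Pi.one_apply, sub_sub_cancel]
  ring

lemma hasDerivAt_trace_pow_mul (A W B : Matrix m m ℝ) (k : ℕ) (t : ℝ) :
    HasDerivAt (fun t : ℝ => ((A + t • W) ^ (k + 1) * B).trace)
      (∑ i ∈ Finset.range (k + 1),
        ((A + t • W) ^ (k - i) * W * (A + t • W) ^ i * B).trace) t := by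
  have h : HasDerivAt (fun t : ℝ => A + t • W) W t := by
    simpa using ((hasDerivAt_id t).smul_const W).const_add A
  have h1 := (h.fun_pow' (k + 1)).mul_const B
  have h2 := (LinearMap.toContinuousLinearMap (traceLinearMap m ℝ ℝ)).hasFDerivAt.comp_hasDerivAt
    t h1
  refine (h2.congr_deriv ?_)
  simp [Finset.sum_mul]

lemma hasDerivAt_trace_pow (A W : Matrix m m ℝ) (k : ℕ) (t : ℝ) :
    HasDerivAt (fun t : ℝ => ((A + t • W) ^ (k + 1)).trace)
      ((k + 1) * ((A + t • W) ^ k * W).trace) t := by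
  have h := hasDerivAt_trace_pow_mul A W 1 k t
  simp only [mul_one] at h
  refine h.congr_deriv ?_
  rw [Finset.sum_congr rfl (g := fun _ => ((A + t • W) ^ k * W).trace)]
  · simp
  · intro i hi
    rw [trace_mul_comm, ← mul_assoc, ← pow_add]
    congr 3
    have := Finset.mem_range.1 hi
    omega

lemma exists_abs_trace_le : ∃ C : ℝ, 0 ≤ C ∧ ∀ A : Matrix m m ℝ, |A.trace| ≤ C * ‖A‖ :=
  ⟨_, norm_nonneg _, (LinearMap.toContinuousLinearMap (traceLinearMap m ℝ ℝ)).le_opNorm⟩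

/-- The second derivative at `0` of `t ↦ entropySeries (A + t • W)`. -/
noncomputable def entropySeriesHessian (A W : Matrix m m ℝ) : ℝ :=
  ∑' k : ℕ, (∑ i ∈ Finset.range (k + 1), (A ^ (k - i) * W * A ^ i * W).trace) / (k + 1)

lemma norm_pow_mul_le (A B : Matrix m m ℝ) (k : ℕ) : ‖A ^ k * B‖ ≤ ‖A‖ ^ k * ‖B‖ := by
  induction k with
  | zero => simp
  | succ k ih =>
    rw [pow_succ', mul_assoc, pow_succ', mul_assoc]
    exact (norm_mul_le _ _).trans (by gcongr)

lemma abs_trace_pow_mul_le {C r : ℝ} (hC : 0 ≤ C) (htr : ∀ A : Matrix m m ℝ, |A.trace| ≤ C * ‖A‖)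
    {A : Matrix m m ℝ} (hA : ‖A‖ ≤ r) (W : Matrix m m ℝ) (k : ℕ) :
    |(A ^ (k + 1) * W).trace| ≤ C * ‖W‖ * r * r ^ k := by
  have hr : 0 ≤ r := (norm_nonneg _).trans hA
  calc |(A ^ (k + 1) * W).trace| ≤ C * (‖A‖ ^ (k + 1) * ‖W‖) := by
        refine (htr _).trans ?_
        gcongr
        exact norm_pow_mul_le _ _ _
    _ ≤ C * (r ^ (k + 1) * ‖W‖) := by gcongr
    _ = _ := by ring

lemma abs_hessian_term_le {C r : ℝ} (hC : 0 ≤ C) (htr : ∀ A : Matrix m m ℝ, |A.trace| ≤ C * ‖A‖)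
    {A : Matrix m m ℝ} (hA : ‖A‖ ≤ r) (W : Matrix m m ℝ) (k : ℕ) :
    |(∑ i ∈ Finset.range (k + 1), (A ^ (k - i) * W * A ^ i * W).trace) / (k + 1)|
      ≤ C * ‖W‖ ^ 2 * r ^ k := by
  have hr : 0 ≤ r := (norm_nonneg _).trans hA
  rw [abs_div, abs_of_pos (by positivity : (0 : ℝ) < k + 1), div_le_iff₀ (by positivity)]
  refine (Finset.abs_sum_le_sum_abs _ _).trans ?_
  refine (Finset.sum_le_card_nsmul _ _ (C * ‖W‖ ^ 2 * r ^ k) fun i hi => ?_).trans_eq ?_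
  · have hik : k - i + i = k := by have := Finset.mem_range.1 hi; omega
    calc |(A ^ (k - i) * W * A ^ i * W).trace|
        ≤ C * (‖A‖ ^ (k - i) * (‖W‖ * (‖A‖ ^ i * ‖W‖))) := by
          refine (htr _).trans ?_
          gcongr
          rw [mul_assoc, mul_assoc]
          refine (norm_pow_mul_le _ _ _).trans ?_
          gcongr
          refine (norm_mul_le _ _).trans ?_
          gcongr
          exact norm_pow_mul_le _ _ _
      _ = C * ‖W‖ ^ 2 * ‖A‖ ^ (k - i + i) := by ring
      _ ≤ _ := by rw [hik]; gcongr
  · simp; ring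

lemma exists_hasDerivAt_entropySeries {A : Matrix m m ℝ} (hA : ‖A‖ < 1) (W : Matrix m m ℝ) :
    ∃ G : ℝ → ℝ, (∀ᶠ t in 𝓝 (0 : ℝ), HasDerivAt (fun t : ℝ => entropySeries (A + t • W)) (G t) t) ∧
      HasDerivAt G (entropySeriesHessian A W) 0 := by
  obtain ⟨C, hC, htr⟩ := exists_abs_trace_le (m := m)
  obtain ⟨r, hAr, hr1⟩ := exists_between hA
  have hr : 0 ≤ r := (norm_nonneg _).trans hAr.le
  have hcont : Continuous fun t : ℝ => ‖A + t • W‖ := by fun_prop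
  obtain ⟨ε, hε, hball⟩ := Metric.eventually_nhds_iff_ball.1
    (hcont.continuousAt.eventually_lt (x₀ := 0) (continuousAt_const (y := r)) (by simpa using hAr))
  have hnorm (t) (ht : t ∈ Metric.ball (0 : ℝ) ε) : ‖A + t • W‖ ≤ r := (hball t ht).le
  have hpre : IsPreconnected (Metric.ball (0 : ℝ) ε) := (convex_ball 0 ε).isPreconnected
  have h0 : (0 : ℝ) ∈ Metric.ball (0 : ℝ) ε := Metric.mem_ball_self hε
  have hgeo (c : ℝ) : Summable fun k : ℕ => c * r ^ k :=
    (summable_geometric_of_lt_one hr hr1).mul_left c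
  have hdivle (x : ℝ) (k : ℕ) : |x / (k + 1)| ≤ |x| := by
    rw [abs_div, abs_of_pos (by positivity : (0 : ℝ) < k + 1)]
    exact div_le_self (abs_nonneg _) (by linarith [(Nat.cast_nonneg k : (0 : ℝ) ≤ k)])
  have hbd1 (k : ℕ) (t) (ht : t ∈ Metric.ball (0 : ℝ) ε) :
      ‖((A + t • W) ^ (k + 1) * W).trace / (k + 1)‖ ≤ C * ‖W‖ * r * r ^ k :=
    (hdivle _ k).trans (abs_trace_pow_mul_le hC htr (hnorm t ht) W k)
  refine ⟨fun t => ∑' k : ℕ, ((A + t • W) ^ (k + 1) * W).trace / (k + 1), ?_, ?_⟩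
  · filter_upwards [Metric.ball_mem_nhds (0 : ℝ) hε] with t ht
    refine hasDerivAt_tsum_of_isPreconnected (hgeo _) Metric.isOpen_ball hpre (fun k y _ => ?_)
      hbd1 h0 ?_ ht
    · refine ((hasDerivAt_trace_pow A W (k + 1) y).div_const _).congr_deriv ?_
      push_cast
      field_simp
      ring
    · refine .of_norm_bounded (hgeo (C * ‖A‖ * r)) fun k => ?_
      have hle : (1 : ℝ) ≤ (k + 1) * (k + 2) := by
        nlinarith [(Nat.cast_nonneg k : (0 : ℝ) ≤ k)]
      rw [Real.norm_eq_abs, abs_div, abs_of_pos (by positivity : (0 : ℝ) < (k + 1) * (k + 2))]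
      refine (div_le_self (abs_nonneg _) hle).trans ?_
      simpa [pow_succ] using abs_trace_pow_mul_le hC htr hAr.le A k
  · have h := hasDerivAt_tsum_of_isPreconnected (hgeo (C * ‖W‖ ^ 2)) Metric.isOpen_ball hpre
      (fun k y _ => (hasDerivAt_trace_pow_mul A W W k y).div_const _)
      (fun k y hy => abs_hessian_term_le hC htr (hnorm y hy) W k) h0
      (.of_norm_bounded (hgeo _) fun k => hbd1 k 0 h0) h0
    simpa [entropySeriesHessian] using h

lemma pow_half_add_le_sum_range {x y : ℝ} (hx : 0 ≤ x) (hy : 0 ≤ y) (k : ℕ) :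
    (k + 1) * ((x + y) / 2) ^ k ≤ ∑ i ∈ Finset.range (k + 1), x ^ (k - i) * y ^ i := by
  induction k with
  | zero => simp
  | succ k ih =>
    have hmean : ((x + y) / 2) ^ (k + 1) ≤ (x ^ (k + 1) + y ^ (k + 1)) / 2 := by
      have := (convexOn_pow (𝕜 := ℝ) (k + 1)).2 hx hy (by norm_num : (0 : ℝ) ≤ 1 / 2)
        (by norm_num : (0 : ℝ) ≤ 1 / 2) (by norm_num)
      simp only [smul_eq_mul] at this
      calc _ = (1 / 2 * x + 1 / 2 * y) ^ (k + 1) := by ring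
        _ ≤ _ := this
        _ = _ := by ring
    have e1 : ∑ i ∈ Finset.range (k + 2), x ^ (k + 1 - i) * y ^ i =
        x * (∑ i ∈ Finset.range (k + 1), x ^ (k - i) * y ^ i) + y ^ (k + 1) := by
      rw [Finset.sum_range_succ, Finset.mul_sum]
      congr 1
      · refine Finset.sum_congr rfl fun i hi => ?_
        rw [Nat.succ_sub (Nat.lt_succ_iff.1 (Finset.mem_range.1 hi)), pow_succ]
        ring
      · simp
    have e2 : ∑ i ∈ Finset.range (k + 2), x ^ (k + 1 - i) * y ^ i =
        y * (∑ i ∈ Finset.range (k + 1), x ^ (k - i) * y ^ i) + x ^ (k + 1) := by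
      rw [Finset.sum_range_succ', Finset.mul_sum]
      congr 1
      · refine Finset.sum_congr rfl fun i hi => ?_
        rw [Nat.add_sub_add_right, pow_succ]
        ring
      · simp
    have hs : 0 ≤ (x + y) / 2 := by positivity
    have := mul_le_mul_of_nonneg_left ih hs
    push_cast
    rw [pow_succ] at hmean ⊢
    nlinarith

lemma trace_conjStarAlgAut_hessian_term (U : unitaryGroup m ℝ) (d : m → ℝ) (V : Matrix m m ℝ)
    (a b : ℕ) :
    (conjStarAlgAut ℝ (Matrix m m ℝ) U (diagonal d) ^ a * conjStarAlgAut ℝ _ U V *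
      conjStarAlgAut ℝ _ U (diagonal d) ^ b * conjStarAlgAut ℝ _ U V).trace =
      ∑ p, ∑ q, d p ^ a * d q ^ b * (V p q * V q p) := by
  simp_rw [← map_pow, ← map_mul, trace_conjStarAlgAut, diagonal_pow, trace, diag_apply]
  refine Finset.sum_congr rfl fun p _ => ?_
  rw [mul_apply]
  refine Finset.sum_congr rfl fun q _ => ?_
  rw [mul_diagonal, diagonal_mul]
  simp only [Pi.pow_apply]
  ring

lemma sum_div_le_entropySeriesHessian (U : unitaryGroup m ℝ) {d : m → ℝ} (hd0 : ∀ i, 0 ≤ d i)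
    (hd1 : ∀ i, d i < 1) {V : Matrix m m ℝ} (hV : V.IsHermitian) :
    ∑ p, ∑ q, V p q ^ 2 * (1 - (d p + d q) / 2)⁻¹ ≤
      entropySeriesHessian (conjStarAlgAut ℝ _ U (diagonal d)) (conjStarAlgAut ℝ _ U V) := by
  have hsymm (p q) : V q p = V p q := by simpa using hV.apply p q
  have hlow : HasSum (fun k : ℕ => ∑ p, ∑ q, V p q ^ 2 * ((d p + d q) / 2) ^ k)
      (∑ p, ∑ q, V p q ^ 2 * (1 - (d p + d q) / 2)⁻¹) :=
    hasSum_sum fun p _ => hasSum_sum fun q _ =>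
      (hasSum_geometric_of_lt_one (by linarith [hd0 p, hd0 q])
        (by linarith [hd1 p, hd1 q])).mul_left _
  obtain ⟨C, hC, htr⟩ := exists_abs_trace_le (m := m)
  have hnorm : ‖conjStarAlgAut ℝ (Matrix m m ℝ) U (diagonal d)‖ < 1 := by
    rw [norm_conjStarAlgAut, l2_opNorm_diagonal, pi_norm_lt_iff one_pos]
    intro i
    rw [Real.norm_eq_abs, abs_of_nonneg (hd0 i)]
    exact hd1 i
  have hsum : Summable fun k : ℕ => (∑ i ∈ Finset.range (k + 1),
      (conjStarAlgAut ℝ (Matrix m m ℝ) U (diagonal d) ^ (k - i) * conjStarAlgAut ℝ _ U V *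
      conjStarAlgAut ℝ _ U (diagonal d) ^ i * conjStarAlgAut ℝ _ U V).trace) / ((k : ℝ) + 1) :=
    .of_norm_bounded ((summable_geometric_of_lt_one (norm_nonneg _) hnorm).mul_left _)
      fun k => abs_hessian_term_le hC htr le_rfl _ k
  refine hasSum_le (fun k => ?_) hlow hsum.hasSum
  simp_rw [trace_conjStarAlgAut_hessian_term]
  rw [le_div_iff₀ (by positivity), Finset.sum_comm (s := Finset.range _), Finset.sum_mul]
  refine Finset.sum_le_sum fun p _ => ?_
  rw [Finset.sum_comm (s := Finset.range _), Finset.sum_mul]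
  refine Finset.sum_le_sum fun q _ => ?_
  rw [← Finset.sum_mul, hsymm p q, ← sq]
  nlinarith [mul_le_mul_of_nonneg_left (pow_half_add_le_sum_range (hd0 p) (hd0 q) k)
    (sq_nonneg (V p q))]

lemma exists_conjStarAlgAut_eq (U : unitaryGroup m ℝ) {W : Matrix m m ℝ} (hW : W.IsHermitian) :
    ∃ V : Matrix m m ℝ, V.IsHermitian ∧ conjStarAlgAut ℝ _ U V = W := by
  refine ⟨(conjStarAlgAut ℝ (Matrix m m ℝ) U).symm W, ?_, StarAlgEquiv.apply_symm_apply _ _⟩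
  rw [IsHermitian, ← star_eq_conjTranspose, ← map_star, star_eq_conjTranspose, hW]

lemma entropySeriesHessian_nonneg {A : Matrix m m ℝ} (hA : A.PosSemidef) (hA1 : ‖A‖ < 1)
    {W : Matrix m m ℝ} (hW : W.IsHermitian) : 0 ≤ entropySeriesHessian A W := by
  obtain ⟨U, hU⟩ := exists_conjStarAlgAut_diagonal hA.1
  obtain ⟨V, hV, rfl⟩ := exists_conjStarAlgAut_eq U hW
  have hd0 := hA.eigenvalues_nonneg
  set d := hA.1.eigenvalues
  have hd1 (i) : d i < 1 := (le_abs_self _).trans_lt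
    ((abs_le_norm_conjStarAlgAut_diagonal U d i).trans_lt (by rwa [← hU]))
  rw [hU]
  refine le_trans ?_ (sum_div_le_entropySeriesHessian U hd0 hd1 hV)
  refine Finset.sum_nonneg fun p _ => Finset.sum_nonneg fun q _ =>
    mul_nonneg (sq_nonneg _) (inv_nonneg.2 ?_)
  linarith [hd1 p, hd1 q]

lemma sq_trace_mul_le_entropySeriesHessian {A : Matrix m m ℝ} (hA : A.PosSemidef) (hA1 : ‖A‖ < 1)
    {W S : Matrix m m ℝ} (hW : W.IsHermitian) (hS : S.IsHermitian) (hSS : S * S = 1) :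
    (W * S).trace ^ 2 ≤ entropySeriesHessian A W * (1 - A).trace := by
  obtain ⟨U, hU⟩ := exists_conjStarAlgAut_diagonal hA.1
  obtain ⟨V, hV, rfl⟩ := exists_conjStarAlgAut_eq U hW
  obtain ⟨T, hT, rfl⟩ := exists_conjStarAlgAut_eq U hS
  have hd0 := hA.eigenvalues_nonneg
  set d := hA.1.eigenvalues
  have hd1 (i) : d i < 1 := (le_abs_self _).trans_lt
    ((abs_le_norm_conjStarAlgAut_diagonal U d i).trans_lt (by rwa [← hU]))
  have hTT : T * T = 1 := by
    rw [← map_mul, ← map_one (conjStarAlgAut ℝ (Matrix m m ℝ) U)] at hSS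
    exact (conjStarAlgAut ℝ (Matrix m m ℝ) U).injective hSS
  have hsymm (p q) : T q p = T p q := by simpa using hT.apply p q
  have hrow (p) : ∑ q, T p q ^ 2 = 1 := by
    have := congrFun (congrFun hTT p) p
    simpa [mul_apply, hsymm p, ← sq] using this
  have hcol (q) : ∑ p, T p q ^ 2 = 1 := by simpa only [hsymm q] using hrow q
  have htrace : (1 - A).trace = ∑ p, ∑ q, T p q ^ 2 * (1 - (d p + d q) / 2) := by
    have e (p q) : T p q ^ 2 * (1 - (d p + d q) / 2) =
        T p q ^ 2 * ((1 - d p) / 2) + T p q ^ 2 * ((1 - d q) / 2) := by ring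
    simp_rw [e, Finset.sum_add_distrib]
    rw [Finset.sum_comm (f := fun p q => T p q ^ 2 * ((1 - d q) / 2))]
    simp_rw [← Finset.sum_mul, hrow, hcol]
    rw [hU, one_sub_conjStarAlgAut_diagonal, trace_conjStarAlgAut, trace_diagonal,
      ← Finset.sum_add_distrib]
    refine Finset.sum_congr rfl fun i _ => ?_
    simp only [Pi.sub_apply, Pi.one_apply]
    ring
  have hw (p q) : 0 < 1 - (d p + d q) / 2 := by linarith [hd1 p, hd1 q]
  have htrace0 : 0 ≤ (1 - A).trace := by
    rw [htrace]
    exact Finset.sum_nonneg fun p _ => Finset.sum_nonneg fun q _ =>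
      mul_nonneg (sq_nonneg _) (hw p q).le
  rw [← map_mul, trace_conjStarAlgAut]
  refine le_trans ?_ (mul_le_mul_of_nonneg_right
    ((sum_div_le_entropySeriesHessian U hd0 hd1 hV).trans_eq (by rw [← hU])) htrace0)
  rw [htrace]
  simp_rw [trace, diag_apply, mul_apply, hsymm, ← Fintype.sum_prod_type']
  refine Finset.sum_sq_le_sum_mul_sum_of_sq_le_mul _ (fun x _ => ?_) (fun x _ => ?_) fun x _ => ?_
  · exact mul_nonneg (sq_nonneg _) (inv_nonneg.2 (hw _ _).le)
  · exact mul_nonneg (sq_nonneg _) (hw _ _).le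
  · rw [mul_mul_mul_comm, inv_mul_cancel₀ (hw x.1 x.2).ne', mul_one, mul_pow]

lemma exists_trace_mul_eq_sum_abs_eigenvalues {Z : Matrix m m ℝ} (hZ : Z.IsHermitian) :
    ∃ S : Matrix m m ℝ, S.IsHermitian ∧ S * S = 1 ∧
      (Z * S).trace = ∑ i, |hZ.eigenvalues i| := by
  obtain ⟨U, hU⟩ := exists_conjStarAlgAut_diagonal hZ
  set d := hZ.eigenvalues
  let s : m → ℝ := fun i => if 0 ≤ d i then 1 else -1
  refine ⟨conjStarAlgAut ℝ _ U (diagonal s), ?_, ?_, ?_⟩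
  · rw [IsHermitian, ← star_eq_conjTranspose, ← map_star, star_eq_conjTranspose,
      diagonal_conjTranspose, star_trivial]
  · have hs : (fun i => s i * s i) = fun _ => 1 := by
      ext i
      simp only [s]
      split_ifs <;> simp
    rw [← map_mul, diagonal_mul_diagonal, hs, diagonal_one, map_one]
  · rw [hU, ← map_mul, trace_conjStarAlgAut, diagonal_mul_diagonal, trace_diagonal]
    refine Finset.sum_congr rfl fun i _ => ?_
    simp only [s]
    split_ifs with h
    · rw [abs_of_nonneg h, mul_one]
    · rw [abs_of_neg (not_le.1 h), mul_neg_one]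

lemma iteratedDeriv_two_fermiDiracEntropy {n : ℕ} {X Z : Matrix (Fin n) (Fin n) ℝ}
    (hX : X.IsHermitian) (hZ : Z.IsHermitian) (hX1 : ‖X‖ < 1) (hX1' : ‖1 - X‖ < 1) :
    iteratedDeriv 2 (fun t : ℝ => fermiDiracEntropy (X + t • Z)) 0 =
      entropySeriesHessian X Z + entropySeriesHessian (1 - X) (-Z) := by
  obtain ⟨G, hG, hG'⟩ := exists_hasDerivAt_entropySeries hX1 Z
  obtain ⟨H, hH, hH'⟩ := exists_hasDerivAt_entropySeries hX1' (-Z)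
  have hcont : Continuous fun t : ℝ => ‖X + t • Z‖ := by fun_prop
  have hcont' : Continuous fun t : ℝ => ‖1 - (X + t • Z)‖ := by fun_prop
  have heq : (fun t : ℝ => fermiDiracEntropy (X + t • Z)) =ᶠ[𝓝 0] fun t : ℝ =>
      -n + (entropySeries (X + t • Z) + entropySeries (1 - X + t • -Z)) := by
    filter_upwards [hcont.continuousAt.eventually_lt (continuousAt_const (y := 1))
        (by simpa using hX1),
      hcont'.continuousAt.eventually_lt (continuousAt_const (y := 1)) (by simpa using hX1')]
      with t ht ht'
    rw [fermiDiracEntropy_eq (hX.add (by rw [IsHermitian, conjTranspose_smul, hZ, star_trivial]))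
      ht ht']
    congr 3
    rw [smul_neg]
    abel
  have hderiv : deriv (fun t : ℝ => fermiDiracEntropy (X + t • Z)) =ᶠ[𝓝 0] fun t => G t + H t := by
    filter_upwards [hG, hH, heq.deriv] with t h1 h2 h3
    rw [h3]
    exact ((h1.add h2).const_add _).deriv
  rw [iteratedDeriv_succ, iteratedDeriv_one, hderiv.deriv_eq]
  exact (hG'.add hH').deriv

end Helpers

theorem stmt17 {n : ℕ} (τ : ℝ) (hτ : 1 ≤ τ)
    (X Z : Matrix (Fin n) (Fin n) ℝ) (hZ : Z.IsHermitian)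
    (hXpos : X.PosDef) (hXlt : ((1 : Matrix (Fin n) (Fin n) ℝ) - X).PosDef)
    (hTr : X.trace ≤ τ) :
    (1 / τ) * (∑ i, |hZ.eigenvalues i|) ^ 2 ≤
      iteratedDeriv 2 (fun t : ℝ => fermiDiracEntropy (X + t • Z)) 0 := by
  have hX1 := norm_lt_one_of_posDef hXpos hXlt
  have hX1' := norm_lt_one_of_posDef hXlt (by rwa [sub_sub_cancel])
  obtain ⟨S, hS, hSS, hZS⟩ := exists_trace_mul_eq_sum_abs_eigenvalues hZ
  rw [iteratedDeriv_two_fermiDiracEntropy hXpos.1 hZ hX1 hX1', ← hZS]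
  have h1 := entropySeriesHessian_nonneg hXpos.posSemidef hX1 hZ
  have h2 := entropySeriesHessian_nonneg hXlt.posSemidef hX1' hZ.neg
  have h3 := sq_trace_mul_le_entropySeriesHessian hXlt.posSemidef hX1' hZ.neg hS hSS
  rw [neg_mul, trace_neg, neg_sq, sub_sub_cancel] at h3
  have h4 := h3.trans (mul_le_mul_of_nonneg_left hTr h2)
  rw [one_div, inv_mul_le_iff₀ (by linarith)]
  nlinarith
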